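/- arXiv:2506.21756 — 2 statements merged into one kernel-verified Lean document; each statement's English description precedes it below -/
import Mathlib

section
/- Every graph with maximum degree Δ can be properly edge-colored with Δ + 1 colors; equivalently, its edge set can be partitioned into at most Δ + 1 matchings. -/
/-- A partial edge colouring: each colour is an involution (a matching), fixed points are the
vertices missing the colour; exactly the (off-diagonal) pairs in `T` are coloured. -/
structure VGood {V K : Type*} (C : K → V → V) (T : Set (Sym2 V)) : Prop where
  inv : ∀ a v, C a (C a v) = v
  disj : ∀ a b v, C a v = C b v → C a v ≠ v → a = b
  col : ∀ u v, u ≠ v → (s(u, v) ∈ T ↔ ∃ a, C a u = v)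

open Classical in
/-- Recolour: give `x y` the colour `d`, uncolour the old `d`-edge at `x`. -/
noncomputable def vmove {V K : Type*} (C : K → V → V) (d : K) (x y : V) : K → V → V :=
  fun a v => if a = d then
    (if v = x then y else if v = y then x else if v = C d x then v else C d v) else C a v

theorem vmove_good {V K : Type*} {C : K → V → V} {T : Set (Sym2 V)} (h : VGood C T)
    {d : K} {x y : V} (hxy : x ≠ y) (hT : s(x, y) ∉ T) (hd : C d y = y) :
    VGood (vmove C d x y) (insert s(x, y) (T \ {s(x, C d x)})) := by
  have hnc : ∀ a, C a x ≠ y := fun a ha => hT ((h.col x y hxy).2 ⟨a, ha⟩)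
  have hnc' : ∀ a, C a y ≠ x := fun a ha => hnc a (by rw [← ha, h.inv])
  have hi := h.inv
  refine ⟨?_, ?_, ?_⟩
  · intro a v
    unfold vmove
    grind
  · intro a b v
    have := h.disj a b v
    unfold vmove
    grind
  · intro u v huv
    have h1 := h.col u v huv
    simp only [Set.mem_insert_iff, Set.mem_sdiff, Set.mem_singleton_iff, Sym2.eq_iff, h1]
    constructor
    · rintro (h2 | ⟨⟨a, ha⟩, h2⟩)
      · refine ⟨d, ?_⟩
        unfold vmove
        grind
      · refine ⟨a, ?_⟩
        unfold vmove
        grind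
    · rintro ⟨a, ha⟩
      have hdis := h.disj a d
      unfold vmove at ha
      grind

theorem vfan {V K : Type*} (x : V) (γ : K) (k : ℕ) : ∀ (C : K → V → V) (T : Set (Sym2 V))
    (y : ℕ → V), VGood C T → s(x, y 0) ∉ T → (∀ i ≤ k, ∀ j ≤ k, y i = y j → i = j) →
    (∀ i ≤ k, y i ≠ x) → (∀ i < k, ∃ a, C a (y i) = y i ∧ C a x = y (i + 1)) →
    C γ x = x → C γ (y k) = y k → ∃ C' : K → V → V, VGood C' (insert s(x, y 0) T) := by
  induction k with
  | zero =>
    intro C T y h hT _ hx _ h1 h2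
    have := vmove_good h (hx 0 le_rfl).symm hT h2
    refine ⟨_, this.inv, this.disj, fun u v huv => ?_⟩
    rw [← this.col u v huv, h1]
    simp only [Set.mem_insert_iff, Set.mem_sdiff, Set.mem_singleton_iff, Sym2.eq_iff]
    grind
  | succ k ih =>
    intro C T y h hT hinj hx hf h1 h2
    obtain ⟨d, hd, hd1⟩ := hf 0 (by omega)
    have hg := vmove_good h (hx 0 (by omega)).symm hT hd
    have hne : ∀ a, a ≠ d → vmove C d x (y 0) a = C a := by
      intro a ha; funext v; simp [vmove, ha]
    simp only [zero_add] at hd1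
    have hy1x := hx 1 (by omega)
    have hy01 : y 0 ≠ y 1 := fun e => by
      have := hinj 0 (by omega) 1 (by omega) e
      omega
    have hγ : γ ≠ d := by
      rintro rfl; exact hy1x (hd1.symm.trans h1)
    have hmem : s(x, y 1) ∈ T := (h.col x (y 1) hy1x.symm).2 ⟨d, hd1⟩
    obtain ⟨C', hC'⟩ := ih _ _ (fun i => y (i + 1)) hg
      (by
        simp only [zero_add, hd1, Set.mem_insert_iff, Set.mem_sdiff, Set.mem_singleton_iff,
          Sym2.eq_iff]
        grind)
      (fun i hi j hj e => by
        have := hinj (i + 1) (by omega) (j + 1) (by omega) e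
        omega)
      (fun i hi => hx (i + 1) (by omega))
      (fun i hi => by
        obtain ⟨a, ha, ha'⟩ := hf (i + 1) (by omega)
        have had : a ≠ d := by
          rintro rfl
          have := hinj 1 (by omega) (i + 1 + 1) (by omega) (hd1.symm.trans ha')
          omega
        exact ⟨a, by rw [hne a had]; exact ha, by rw [hne a had]; exact ha'⟩)
      (by rw [hne γ hγ]; exact h1) (by rw [hne γ hγ]; exact h2)
    refine ⟨C', ?_⟩
    convert hC' using 1
    ext e
    simp only [zero_add, hd1, Set.mem_insert_iff, Set.mem_sdiff, Set.mem_singleton_iff]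
    grind

/-- In the alternating component of an `f`-fixed point there is at most one `g`-fixed point. -/
theorem vcomp {V : Type*} (f g : V → V) (hf : ∀ v, f (f v) = v) (hg : ∀ v, g (g v) = v)
    (x : V) (hx : f x = x) :
    ∃ S : Set V, x ∈ S ∧ (∀ v, v ∈ S → f v ∈ S) ∧ (∀ v, v ∈ S → g v ∈ S) ∧
      ∀ p ∈ S, ∀ q ∈ S, g p = p → g q = q → p = q := by
  set h : V → V := fun v => f (g v) with hh
  have hinj : Function.Injective h := by
    intro u v e
    have e1 : f (g u) = f (g v) := e
    have e2 := congrArg f e1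
    rw [hf, hf] at e2
    have e3 := congrArg g e2
    rwa [hg, hg] at e3
  have key : ∀ n, h^[n] (f (h^[n] x)) = x := by
    intro n
    induction n with
    | zero => simpa using hx
    | succ n ih =>
      rw [Function.iterate_succ_apply, Function.iterate_succ_apply']
      have : h (f (h (h^[n] x))) = f (h^[n] x) := by simp only [hh, hf, hg]
      rw [this, ih]
  have per : ∀ n, g (h^[n] x) = h^[n] x → Function.IsPeriodicPt h (2 * n + 1) x := by
    intro n e
    have e1 : h (h^[n] x) = f (h^[n] x) := by
      change f (g (h^[n] x)) = _
      rw [e]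
    have := key n
    rw [← e1, ← Function.iterate_succ_apply' h, ← Function.iterate_add_apply] at this
    have e2 : 2 * n + 1 = n + (n + 1) := by ring
    unfold Function.IsPeriodicPt Function.IsFixedPt
    rw [e2]; exact this
  have main : ∀ n m, n ≤ m → g (h^[n] x) = h^[n] x → g (h^[m] x) = h^[m] x →
      h^[n] x = h^[m] x := by
    intro n m hnm en em
    have d1 := (per n en).minimalPeriod_dvd
    have d2 := (per m em).minimalPeriod_dvd
    obtain ⟨r, rfl⟩ := Nat.exists_eq_add_of_le hnm
    have d3 : Function.minimalPeriod h x ∣ 2 * r := by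
      have := Nat.dvd_sub d2 d1
      have e : 2 * (n + r) + 1 - (2 * n + 1) = 2 * r := by omega
      rwa [e] at this
    have cop : Nat.Coprime (Function.minimalPeriod h x) 2 := by
      have : Nat.Coprime (2 * n + 1) 2 := by simp
      exact Nat.Coprime.coprime_dvd_left d1 this
    have d4 := cop.dvd_of_dvd_mul_left d3
    have : Function.IsPeriodicPt h r x := Function.isPeriodicPt_iff_minimalPeriod_dvd.2 d4
    rw [Function.iterate_add_apply, this.eq]
  refine ⟨{v | ∃ n, v = h^[n] x ∨ v = g (h^[n] x)}, ⟨0, Or.inl rfl⟩, ?_, ?_, ?_⟩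
  · rintro v ⟨n, rfl | rfl⟩
    · cases n with
      | zero => exact ⟨0, Or.inl hx⟩
      | succ n =>
        refine ⟨n, Or.inr ?_⟩
        rw [Function.iterate_succ_apply']
        simp only [hh, hf]
    · refine ⟨n + 1, Or.inl ?_⟩
      rw [Function.iterate_succ_apply']
  · rintro v ⟨n, rfl | rfl⟩
    · exact ⟨n, Or.inr rfl⟩
    · exact ⟨n, Or.inl (hg _)⟩
  · have fixd : ∀ p, (∃ n, p = h^[n] x ∨ p = g (h^[n] x)) → g p = p → ∃ n, p = h^[n] x := by
      rintro p ⟨n, hp | hp⟩ e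
      · exact ⟨n, hp⟩
      · refine ⟨n, ?_⟩
        rw [← e, hp, hg]
    intro p hp q hq ep eq
    obtain ⟨n, rfl⟩ := fixd p hp ep
    obtain ⟨m, rfl⟩ := fixd q hq eq
    rcases le_total n m with hnm | hnm
    · exact main n m hnm ep eq
    · exact (main m n hnm eq ep).symm

open Classical in
/-- Kempe swap of colours `α`, `β` outside of `S`. -/
noncomputable def vkempe {V K : Type*} (C : K → V → V) (α β : K) (S : Set V) : K → V → V :=
  fun a v => if v ∈ S then C a v else C (Equiv.swap α β a) v

theorem vkempe_good {V K : Type*} {C : K → V → V} {T : Set (Sym2 V)} (h : VGood C T)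
    {α β : K} {S : Set V} (hα : ∀ v, v ∈ S → C α v ∈ S) (hβ : ∀ v, v ∈ S → C β v ∈ S) :
    VGood (vkempe C α β S) T := by
  classical
  have hi := h.inv
  refine ⟨?_, ?_, ?_⟩
  · intro a v
    have h1 := hα (C α v)
    have h2 := hβ (C β v)
    have h3 := hα v
    have h4 := hβ v
    rw [hi] at h1 h2
    by_cases ha : a = α
    · subst ha
      simp only [vkempe, Equiv.swap_apply_left]
      grind
    by_cases hb : a = β
    · subst hb
      simp only [vkempe, Equiv.swap_apply_right]
      grind
    simp only [vkempe, Equiv.swap_apply_of_ne_of_ne ha hb]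
    grind
  · intro a b v
    simp only [vkempe]
    split_ifs with hv
    · exact h.disj a b v
    · intro e1 e2
      exact (Equiv.swap α β).injective (h.disj _ _ v e1 e2)
  · intro u v huv
    rw [h.col u v huv]
    simp only [vkempe]
    split_ifs with hv
    · rfl
    · constructor
      · rintro ⟨a, ha⟩
        exact ⟨Equiv.swap α β a, by rwa [Equiv.swap_apply_self]⟩
      · rintro ⟨a, ha⟩
        exact ⟨_, ha⟩

theorem vstep {V K : Type*} [Finite V] {C : K → V → V} {T : Set (Sym2 V)} (h : VGood C T)
    (hmiss : ∀ v, ∃ a, C a v = v) {x y₀ : V} (hxy : x ≠ y₀) (hT : s(x, y₀) ∉ T) :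
    ∃ C' : K → V → V, VGood C' (insert s(x, y₀) T) := by
  classical
  choose m hm using hmiss
  let y : ℕ → V := fun n => Nat.rec y₀ (fun _ v => C (m v) x) n
  have y0 : y 0 = y₀ := rfl
  have ys : ∀ n, y (n + 1) = C (m (y n)) x := fun n => rfl
  -- first bad index
  have hex : ∃ n, y (n + 1) = x ∨ ∃ j ≤ n, y (n + 1) = y j := by
    obtain ⟨a, b, hab, e⟩ := Finite.exists_ne_map_eq_of_infinite y
    rcases lt_or_gt_of_ne hab with hl | hl
    · obtain ⟨n, rfl⟩ : ∃ n, b = n + 1 := ⟨b - 1, by omega⟩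
      exact ⟨n, Or.inr ⟨a, by omega, e.symm⟩⟩
    · obtain ⟨n, rfl⟩ : ∃ n, a = n + 1 := ⟨a - 1, by omega⟩
      exact ⟨n, Or.inr ⟨b, by omega, e⟩⟩
  obtain ⟨k, hk, hmin⟩ : ∃ k, (y (k + 1) = x ∨ ∃ j ≤ k, y (k + 1) = y j) ∧
      ∀ n < k, ¬ (y (n + 1) = x ∨ ∃ j ≤ n, y (n + 1) = y j) := by
    have hwf := WellFounded.has_min (wellFounded_lt (α := ℕ))
      {n | y (n + 1) = x ∨ ∃ j ≤ n, y (n + 1) = y j} hex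
    obtain ⟨k, hk, hmin⟩ := hwf
    exact ⟨k, hk, fun n hn hp => hmin n hp hn⟩
  have hx : ∀ i ≤ k, y i ≠ x := by
    intro i hi
    cases i with
    | zero => exact hxy.symm
    | succ i => exact fun e => hmin i (by omega) (Or.inl e)
  have hlt : ∀ i j, i < j → j ≤ k → y i ≠ y j := by
    intro i j hij hj e
    obtain ⟨n, rfl⟩ : ∃ n, j = n + 1 := ⟨j - 1, by omega⟩
    exact hmin n (by omega) (Or.inr ⟨i, by omega, e.symm⟩)
  have hinj : ∀ i ≤ k, ∀ j ≤ k, y i = y j → i = j := by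
    intro i hi j hj e
    rcases lt_trichotomy i j with hl | hl | hl
    · exact absurd e (hlt i j hl hj)
    · exact hl
    · exact absurd e.symm (hlt j i hl hi)
  have hT' : s(x, y 0) ∉ T := hT
  change ∃ C' : K → V → V, VGood C' (insert s(x, y 0) T)
  rcases hk with hk | ⟨j, hj, hk⟩
  · exact vfan x (m (y k)) k C T y h hT' hinj hx (fun i _ => ⟨m (y i), hm _, rfl⟩) hk (hm _)
  -- the repeat case
  obtain ⟨i, rfl⟩ : ∃ i, j = i + 1 := by
    cases j with
    | zero => exact absurd ((h.col x y₀ hxy).2 ⟨m (y k), hk⟩) hT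
    | succ i => exact ⟨i, rfl⟩
  have hαx := hm x
  generalize hα : m x = α at hαx
  have hβk := hm (y k)
  have hβx : C (m (y k)) x = y (i + 1) := hk
  have hβi := hm (y i)
  have hβeq : m (y k) = m (y i) :=
    h.disj _ _ x hβx (by rw [hβx]; exact hx _ hj)
  rw [← hβeq] at hβi
  generalize hβ : m (y k) = β at *
  obtain ⟨S, hxS, hSα, hSβ, hS⟩ := vcomp (C α) (C β) (h.inv α) (h.inv β) x hαx
  have hg := vkempe_good h hSα hSβ
  have hCx : ∀ a, vkempe C α β S a x = C a x := by
    intro a; simp [vkempe, hxS]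
  -- fan edges survive
  have hfan : ∀ l < k, (l = i → y i ∈ S) →
      ∃ a, vkempe C α β S a (y l) = y l ∧ vkempe C α β S a x = y (l + 1) := by
    intro l hl hli
    refine ⟨m (y l), ?_, (hCx _).trans rfl⟩
    by_cases hlS : y l ∈ S
    · simp only [vkempe, hlS, if_true]; exact hm _
    · have h1 : m (y l) ≠ α := by
        intro e
        apply hx (l + 1) (by omega)
        rw [ys, e, hαx]
      have h2 : m (y l) ≠ β := by
        intro e
        have e1 : y (l + 1) = y (i + 1) := by rw [ys, e, hβx]
        have e2 := hinj (l + 1) (by omega) (i + 1) hj e1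
        have e3 : l = i := by omega
        subst e3
        exact hlS (hli rfl)
      simp only [vkempe, hlS, if_false, Equiv.swap_apply_of_ne_of_ne h1 h2]
      exact hm _
  have hout : ∀ v, v ∉ S → C β v = v → vkempe C α β S α v = v := by
    intro v hv e
    simp only [vkempe, hv, if_false, Equiv.swap_apply_left, e]
  by_cases hiS : y i ∈ S
  · have hkS : y k ∉ S := by
      intro hkS
      have := hinj i (by omega) k le_rfl (hS _ hiS _ hkS hβi hβk)
      omega
    exact vfan x α k _ T y hg hT' hinj hx (fun l hl => hfan l hl fun _ => hiS)
      ((hCx _).trans hαx) (hout _ hkS hβk)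
  · exact vfan x α i _ T y hg hT' (fun a ha b hb => hinj a (by omega) b (by omega))
      (fun a ha => hx a (by omega))
      (fun l hl => hfan l (by omega) fun e => absurd e (by omega))
      ((hCx _).trans hαx) (hout _ hiS hβi)

/-- Vizing's theorem: every graph with maximum degree at most `Δ` has a proper
    edge coloring with `Δ + 1` colors. -/
theorem vizing {V : Type*} [Fintype V] (G : SimpleGraph V) (Δ : ℕ)
    (h : ∀ v, (G.neighborSet v).ncard ≤ Δ) :
    ∃ f : G.edgeSet → Fin (Δ + 1),
      ∀ e₁ e₂ : G.edgeSet, e₁ ≠ e₂ →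
        (∃ v, v ∈ (e₁ : Sym2 V) ∧ v ∈ (e₂ : Sym2 V)) → f e₁ ≠ f e₂ := by
  classical
  have main : ∀ T : Set (Sym2 V), T.Finite → T ⊆ G.edgeSet →
      ∃ C : Fin (Δ + 1) → V → V, VGood C T := by
    intro T hT
    induction T, hT using Set.Finite.induction_on with
    | empty =>
      intro _
      refine ⟨fun _ v => v, fun _ _ => rfl, fun _ _ _ _ h => absurd rfl h, fun u v huv => ?_⟩
      simp [huv]
    | @insert e T he _ ih =>
      intro hsub
      obtain ⟨C, hC⟩ := ih (fun e' he' => hsub (Set.mem_insert_of_mem _ he'))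
      induction e with
      | h x y =>
      have hadj : G.Adj x y := hsub (Set.mem_insert _ _)
      refine vstep hC ?_ hadj.ne he
      intro v
      by_contra! hne
      have hmem : ∀ a, C a v ∈ G.neighborSet v := fun a =>
        hsub (Set.mem_insert_of_mem _ ((hC.col v (C a v) (hne a).symm).2 ⟨a, rfl⟩))
      have hinj : Function.Injective (fun a => C a v) := fun a b e => hC.disj a b v e (hne a)
      have h1 : (Set.range (fun a => C a v)).ncard ≤ (G.neighborSet v).ncard :=
        Set.ncard_le_ncard (by rintro _ ⟨a, rfl⟩; exact hmem a) (Set.toFinite _)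
      rw [← Set.image_univ, Set.ncard_image_of_injective _ hinj, Set.ncard_univ,
        Nat.card_fin] at h1
      have := h v
      omega
  obtain ⟨C, hC⟩ := main G.edgeSet (Set.toFinite _) subset_rfl
  have hcol : ∀ e : G.edgeSet, ∃ a, ∀ u v, (e : Sym2 V) = s(u, v) → C a u = v := by
    rintro ⟨e, he⟩
    induction e with
    | h x y =>
    have hadj : G.Adj x y := he
    obtain ⟨a, ha⟩ := (hC.col x y hadj.ne).1 he
    refine ⟨a, fun u v e => ?_⟩
    rcases Sym2.eq_iff.1 e with ⟨rfl, rfl⟩ | ⟨rfl, rfl⟩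
    · exact ha
    · rw [← ha, hC.inv]
  choose f hf using hcol
  refine ⟨f, ?_⟩
  rintro e₁ e₂ hne ⟨v, ⟨w₁, h₁⟩, ⟨w₂, h₂⟩⟩ hfe
  apply hne
  have a1 := hf e₁ v w₁ h₁
  have a2 := hf e₂ v w₂ h₂
  apply Subtype.ext
  rw [h₁, h₂, ← a1, ← a2, hfe]
end

section
/- Let F be a uniformly random permutation of [n] conditioned on having all cycles of length at least 3 (equivalently, a uniformly random 2-factor). Then for any ε ∈ (0, 1/2), with probability at least 1 - 2ε there is a cycle of length at least εn. -/
open Finset in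
/-- Multisets with sum `n` and all parts at least 3. -/
noncomputable def goodTypes (n : ℕ) : Finset (Multiset ℕ) :=
  ((Finset.univ : Finset (Nat.Partition n)).image Nat.Partition.parts).filter
    (fun m => ∀ c ∈ m, 3 ≤ c)

theorem mem_goodTypes (n : ℕ) (m : Multiset ℕ) :
    m ∈ goodTypes n ↔ m.sum = n ∧ ∀ c ∈ m, 3 ≤ c := by
  unfold goodTypes
  simp only [Finset.mem_filter, Finset.mem_image, Finset.mem_univ, true_and]
  constructor
  · rintro ⟨⟨p, rfl⟩, h⟩
    exact ⟨p.parts_sum, h⟩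
  · rintro ⟨h, h3⟩
    exact ⟨⟨⟨m, fun {i} hi => by have := h3 i hi; omega, h⟩, rfl⟩, h3⟩

/-- The weight `1 / z_m`. -/
noncomputable def wt (m : Multiset ℕ) : ℝ :=
  ((m.prod * ∏ k ∈ m.toFinset, (m.count k).factorial : ℕ) : ℝ)⁻¹

theorem wt_nonneg (m : Multiset ℕ) : 0 ≤ wt m := by
  unfold wt; positivity

theorem prod_count_cons (k : ℕ) (m : Multiset ℕ) :
    ∏ j ∈ (k ::ₘ m).toFinset, ((k ::ₘ m).count j).factorial
      = (m.count k + 1) * ∏ j ∈ m.toFinset, (m.count j).factorial := by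
  have h1 : ∏ j ∈ m.toFinset, (m.count j).factorial
      = ∏ j ∈ (k ::ₘ m).toFinset, (m.count j).factorial := by
    apply Finset.prod_subset
    · intro x hx; simp at hx ⊢; exact Or.inr hx
    · intro x _ hx
      have : x ∉ m := by simpa using hx
      simp [Multiset.count_eq_zero_of_notMem this]
  have hk : k ∈ (k ::ₘ m).toFinset := by simp
  rw [h1, ← Finset.mul_prod_erase _ _ hk, ← Finset.mul_prod_erase _ _ hk, ← mul_assoc]
  congr 1
  · rw [Multiset.count_cons_self, Nat.factorial_succ]
  · apply Finset.prod_congr rfl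
    intro x hx
    rw [Multiset.count_cons_of_ne (Finset.ne_of_mem_erase hx)]

theorem wt_cons (k : ℕ) (hk : 0 < k) (m : Multiset ℕ) :
    (k : ℝ) * (k ::ₘ m).count k * wt (k ::ₘ m) = wt m := by
  unfold wt
  rw [prod_count_cons, Multiset.prod_cons, Multiset.count_cons_self]
  have h1 : (k : ℝ) ≠ 0 := by positivity
  have h2 : ((m.count k : ℝ) + 1) ≠ 0 := by positivity
  push_cast
  simp only [mul_inv]
  field_simp

/-- The probability that a random permutation of `[n]` has all cycles of length at least 3. -/
noncomputable def pr (n : ℕ) : ℝ := ∑ m ∈ goodTypes n, wt m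

theorem pr_nonneg (n : ℕ) : 0 ≤ pr n := Finset.sum_nonneg fun m _ => wt_nonneg m

theorem sum_count (n k : ℕ) (hk : 3 ≤ k) (hkn : k ≤ n) :
    ∑ m ∈ goodTypes n, (k : ℝ) * m.count k * wt m = pr (n - k) := by
  unfold pr
  have h1 : ∑ m ∈ goodTypes n, (k : ℝ) * m.count k * wt m
      = ∑ m ∈ (goodTypes n).filter (fun m => k ∈ m), (k : ℝ) * m.count k * wt m := by
    symm
    apply Finset.sum_subset (Finset.filter_subset _ _)
    intro m hm hm'
    have : k ∉ m := fun h => hm' (Finset.mem_filter.2 ⟨hm, h⟩)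
    simp [Multiset.count_eq_zero_of_notMem this]
  rw [h1]
  symm
  refine Finset.sum_bij (fun m _ => k ::ₘ m) ?_ ?_ ?_ ?_
  · intro m hm
    rw [mem_goodTypes] at hm
    simp only [Finset.mem_filter, mem_goodTypes, Multiset.sum_cons, Multiset.mem_cons, true_or,
      and_true]
    refine ⟨by omega, ?_⟩
    rintro c (rfl | hc)
    · exact hk
    · exact hm.2 c hc
  · intro a _ b _ h
    exact (Multiset.cons_inj_right k).1 h
  · intro m hm
    simp only [Finset.mem_filter, mem_goodTypes] at hm
    obtain ⟨⟨hs, h3⟩, hkm⟩ := hm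
    obtain ⟨t, rfl⟩ := Multiset.exists_cons_of_mem hkm
    refine ⟨t, ?_, rfl⟩
    rw [mem_goodTypes]
    rw [Multiset.sum_cons] at hs
    exact ⟨by omega, fun c hc => h3 c (Multiset.mem_cons_of_mem hc)⟩
  · intro m _
    exact (wt_cons k (by omega) m).symm

theorem sum_eq_sum_Icc (n : ℕ) (m : Multiset ℕ) (hm : m ∈ goodTypes n) :
    (n : ℝ) = ∑ k ∈ Finset.Icc 3 n, (k : ℝ) * m.count k := by
  rw [mem_goodTypes] at hm
  obtain ⟨hs, h3⟩ := hm
  have h : m.sum = ∑ k ∈ Finset.Icc 3 n, m.count k * k := by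
    have := Finset.sum_multiset_count_of_subset m (Finset.Icc 3 n) (by
      intro x hx
      have hx : x ∈ m := by simpa using hx
      have := Multiset.le_sum_of_mem hx
      exact Finset.mem_Icc.2 ⟨h3 x hx, by omega⟩)
    simpa using this
  rw [hs] at h
  conv_lhs => rw [h]
  push_cast
  exact Finset.sum_congr rfl fun k _ => mul_comm _ _

theorem pr_rec (n : ℕ) : (n : ℝ) * pr n = ∑ k ∈ Finset.Icc 3 n, pr (n - k) := by
  have : (n : ℝ) * pr n = ∑ m ∈ goodTypes n, ∑ k ∈ Finset.Icc 3 n, (k : ℝ) * m.count k * wt m := by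
    unfold pr
    rw [Finset.mul_sum]
    refine Finset.sum_congr rfl fun m hm => ?_
    conv_lhs => rw [sum_eq_sum_Icc n m hm]
    rw [Finset.sum_mul]
  rw [this, Finset.sum_comm]
  refine Finset.sum_congr rfl fun k hk => ?_
  rw [Finset.mem_Icc] at hk
  exact sum_count n k hk.1 hk.2

theorem pr_rec' (n : ℕ) : ((n : ℝ) + 2) * pr (n + 2) = ∑ i ∈ Finset.range n, pr i := by
  have := pr_rec (n + 2)
  push_cast at this
  rw [this]
  refine Finset.sum_bij' (fun k _ => n + 2 - k) (fun i _ => n + 2 - i) ?_ ?_ ?_ ?_ ?_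
  all_goals intro a ha; simp only [Finset.mem_Icc, Finset.mem_range] at *
  all_goals omega

theorem pr_zero : pr 0 = 1 := by
  have : goodTypes 0 = {0} := by
    ext m
    rw [mem_goodTypes, Finset.mem_singleton]
    constructor
    · rintro ⟨h, h3⟩
      rw [Multiset.sum_eq_zero_iff] at h
      refine Multiset.eq_zero_of_forall_notMem fun a ha => ?_
      have := h a ha
      have := h3 a ha
      omega
    · rintro rfl; simp
  simp [pr, this, wt]

theorem pr_one : pr 1 = 0 := by simpa using pr_rec 1

theorem pr_two : pr 2 = 0 := by simpa using pr_rec' 0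

theorem pr_bounds (n : ℕ) (hn : 3 ≤ n) : 1 / 6 ≤ pr n ∧ pr n ≤ 1 / 3 := by
  induction n using Nat.strong_induction_on with
  | _ n ih =>
    obtain ⟨j, rfl⟩ : ∃ j, n = j + 2 := ⟨n - 2, by omega⟩
    have hrec := pr_rec' j
    by_cases h1 : j = 1
    · subst h1
      norm_num [pr_zero] at hrec ⊢
      constructor <;> linarith
    by_cases h2 : j = 2
    · subst h2
      norm_num [pr_zero, pr_one, Finset.sum_range_succ] at hrec ⊢
      constructor <;> linarith
    obtain ⟨i, rfl⟩ : ∃ i, j = 3 + i := ⟨j - 3, by omega⟩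
    rw [Finset.sum_range_add] at hrec
    simp only [Finset.sum_range_succ, Finset.sum_range_zero, pr_zero, pr_one, pr_two] at hrec
    have hl : (i : ℝ) * (1 / 6) ≤ ∑ x ∈ Finset.range i, pr (3 + x) := by
      have := Finset.card_nsmul_le_sum (Finset.range i) (fun x => pr (3 + x)) (1 / 6) (by
        intro x hx
        rw [Finset.mem_range] at hx
        exact (ih (3 + x) (by omega) (by omega)).1)
      simpa using this
    have hu : ∑ x ∈ Finset.range i, pr (3 + x) ≤ (i : ℝ) * (1 / 3) := by
      have := Finset.sum_le_card_nsmul (Finset.range i) (fun x => pr (3 + x)) (1 / 3) (by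
        intro x hx
        rw [Finset.mem_range] at hx
        exact (ih (3 + x) (by omega) (by omega)).2)
      simpa using this
    push_cast at hrec
    have hi : (0 : ℝ) ≤ i := by positivity
    constructor
    · by_contra hc
      push Not at hc
      nlinarith
    · by_contra hc
      push Not at hc
      nlinarith

open Classical in
theorem card_perm (n : ℕ) (Q : Multiset ℕ → Prop) :
    (Nat.card {σ : Equiv.Perm (Fin n) //
        (σ.support = Finset.univ ∧ ∀ c ∈ σ.cycleType, 3 ≤ c) ∧ Q σ.cycleType} : ℝ)
      = n.factorial * ∑ m ∈ (goodTypes n).filter Q, wt m := by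
  have hG : ∀ σ : Equiv.Perm (Fin n),
      ((σ.support = Finset.univ ∧ ∀ c ∈ σ.cycleType, 3 ≤ c) ∧ Q σ.cycleType) ↔
        σ.cycleType ∈ (goodTypes n).filter Q := by
    intro σ
    rw [Finset.mem_filter, mem_goodTypes, Equiv.Perm.sum_cycleType, ← Finset.card_eq_iff_eq_univ,
      Fintype.card_fin]
  have h1 : Nat.card {σ : Equiv.Perm (Fin n) //
        (σ.support = Finset.univ ∧ ∀ c ∈ σ.cycleType, 3 ≤ c) ∧ Q σ.cycleType}
      = (Finset.univ.filter fun σ : Equiv.Perm (Fin n) =>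
          σ.cycleType ∈ (goodTypes n).filter Q).card := by
    rw [Nat.card_congr (Equiv.subtypeEquivRight hG), Nat.card_eq_fintype_card,
      Fintype.card_subtype]
  rw [h1, Finset.card_eq_sum_card_fiberwise (f := fun σ : Equiv.Perm (Fin n) => σ.cycleType)
    (t := (goodTypes n).filter Q) (by intro σ hσ; simpa using hσ)]
  push_cast
  rw [Finset.mul_sum]
  refine Finset.sum_congr rfl fun m hm => ?_
  have h2 : (Finset.univ.filter fun σ : Equiv.Perm (Fin n) =>
          σ.cycleType ∈ (goodTypes n).filter Q).filter (fun σ => σ.cycleType = m)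
      = Finset.univ.filter fun σ : Equiv.Perm (Fin n) => σ.cycleType = m := by
    ext σ
    simp only [Finset.mem_filter, Finset.mem_univ, true_and]
    constructor
    · exact fun h => h.2
    · rintro rfl; exact ⟨Finset.mem_filter.1 hm, rfl⟩
  rw [h2]
  have hm' := (mem_goodTypes n m).1 (Finset.mem_filter.1 hm).1
  have h3 := Equiv.Perm.card_of_cycleType_mul_eq (Fin n) m
  rw [if_pos ⟨by simp [hm'.1], fun a ha => by have := hm'.2 a ha; omega⟩] at h3
  simp only [Fintype.card_fin, hm'.1, Nat.sub_self, Nat.factorial_zero, one_mul] at h3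
  have h4 : (m.prod * ∏ k ∈ m.toFinset, (m.count k).factorial : ℕ) ≠ 0 := by
    intro h
    rw [h, mul_zero] at h3
    exact (Nat.factorial_ne_zero n) h3.symm
  have h4' : ((m.prod * ∏ k ∈ m.toFinset, (m.count k).factorial : ℕ) : ℝ) ≠ 0 := by
    exact_mod_cast h4
  unfold wt
  rw [eq_mul_inv_iff_mul_eq₀ h4']
  exact_mod_cast h3

set_option maxHeartbeats 1000000 in
open Classical in
theorem bad_bound (n : ℕ) (hn : 3 ≤ n) (ε : ℝ) (hε0 : 0 < ε) (hε : ε < 1 / 2) :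
    ∑ m ∈ (goodTypes n).filter (fun m : Multiset ℕ => ¬ ∃ c ∈ m, ε * n ≤ (c : ℝ)), wt m ≤ 2 * ε * pr n := by
  have hn0 : (0 : ℝ) < n := by positivity
  set K := (Finset.Icc 3 n).filter (fun k : ℕ => (k : ℝ) < ε * n) with hK
  have hsum : (n : ℝ) * ∑ m ∈ (goodTypes n).filter (fun m : Multiset ℕ => ¬ ∃ c ∈ m, ε * n ≤ (c : ℝ)), wt m
      ≤ ∑ k ∈ K, pr (n - k) := by
    have e1 : (n : ℝ) * ∑ m ∈ (goodTypes n).filter (fun m : Multiset ℕ => ¬ ∃ c ∈ m, ε * n ≤ (c : ℝ)), wt m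
        = ∑ m ∈ (goodTypes n).filter (fun m : Multiset ℕ => ¬ ∃ c ∈ m, ε * n ≤ (c : ℝ)),
          ∑ k ∈ K, (k : ℝ) * m.count k * wt m := by
      rw [Finset.mul_sum]
      refine Finset.sum_congr rfl fun m hm => ?_
      obtain ⟨hm, hb⟩ := Finset.mem_filter.1 hm
      conv_lhs => rw [sum_eq_sum_Icc n m hm]
      rw [Finset.sum_mul]
      symm
      apply Finset.sum_subset (Finset.filter_subset _ _)
      intro k hk hk'
      have : k ∉ m := fun h => hk' (Finset.mem_filter.2 ⟨hk, by
        by_contra hc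
        exact hb ⟨k, h, not_lt.1 hc⟩⟩)
      simp [Multiset.count_eq_zero_of_notMem this]
    rw [e1]
    calc _ ≤ ∑ m ∈ goodTypes n, ∑ k ∈ K, (k : ℝ) * m.count k * wt m := by
          apply Finset.sum_le_sum_of_subset_of_nonneg (Finset.filter_subset _ _)
          intro m _ _
          exact Finset.sum_nonneg fun k _ => mul_nonneg
            (mul_nonneg (Nat.cast_nonneg _) (Nat.cast_nonneg _)) (wt_nonneg m)
      _ = _ := by
          rw [Finset.sum_comm]
          refine Finset.sum_congr rfl fun k hk => ?_
          have := Finset.mem_Icc.1 (Finset.mem_filter.1 hk).1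
          exact sum_count n k this.1 this.2
  have hle : ∑ k ∈ K, pr (n - k) ≤ K.card * (2 * pr n) := by
    rw [← nsmul_eq_mul]
    apply Finset.sum_le_card_nsmul
    intro k hk
    obtain ⟨h1, h2⟩ := Finset.mem_filter.1 hk
    have h1 := Finset.mem_Icc.1 h1
    have h3 : 2 * k < n := by
      have : (2 * k : ℝ) < n := by nlinarith
      exact_mod_cast this
    have := (pr_bounds (n - k) (by omega)).2
    have := (pr_bounds n hn).1
    linarith
  have hcard : (K.card : ℝ) ≤ ε * n := by
    have : K ⊆ Finset.Icc 1 ⌊ε * n⌋₊ := by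
      intro k hk
      obtain ⟨h1, h2⟩ := Finset.mem_filter.1 hk
      have h1 := Finset.mem_Icc.1 h1
      exact Finset.mem_Icc.2 ⟨by omega, Nat.le_floor h2.le⟩
    have := Finset.card_le_card this
    rw [Nat.card_Icc, Nat.add_sub_cancel] at this
    calc (K.card : ℝ) ≤ (⌊ε * n⌋₊ : ℝ) := by exact_mod_cast this
      _ ≤ ε * n := Nat.floor_le (mul_nonneg hε0.le hn0.le)
  have hp := pr_nonneg n
  have : (K.card : ℝ) * (2 * pr n) ≤ ε * n * (2 * pr n) :=
    mul_le_mul_of_nonneg_right hcard (mul_nonneg zero_le_two hp)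
  refine le_of_mul_le_mul_left ?_ hn0
  linarith

/-- For a uniformly random permutation of `[n]` conditioned on having all
    cycles of length at least 3 (equivalently a uniformly random 2-factor),
    for any `ε ∈ (0, 1/2)`, with probability at least `1 - 2ε` there is a
    cycle of length at least `ε·n`. -/
theorem random_two_factor_long_cycle (n : ℕ) (hn : 3 ≤ n) (ε : ℝ)
    (hε0 : 0 < ε) (hε : ε < 1 / 2) :
    (1 - 2 * ε) * (Nat.card {σ : Equiv.Perm (Fin n) //
        σ.support = Finset.univ ∧ ∀ c ∈ σ.cycleType, 3 ≤ c} : ℝ) ≤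
      (Nat.card {σ : Equiv.Perm (Fin n) //
        (σ.support = Finset.univ ∧ ∀ c ∈ σ.cycleType, 3 ≤ c) ∧
          ∃ c ∈ σ.cycleType, ε * n ≤ (c : ℝ)} : ℝ) := by
  classical
  have hA := card_perm n (fun _ => True)
  have hB := card_perm n (fun m : Multiset ℕ => ∃ c ∈ m, ε * n ≤ (c : ℝ))
  simp only [and_true, Finset.filter_true] at hA
  rw [hA, hB]
  have hbad := bad_bound n hn ε hε0 hε
  have hsplit := Finset.sum_filter_add_sum_filter_not (goodTypes n)
    (fun m : Multiset ℕ => ∃ c ∈ m, ε * n ≤ (c : ℝ)) wt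
  have hf : (0 : ℝ) ≤ n.factorial := by positivity
  change _ = pr n at hsplit
  change (1 - 2 * ε) * (n.factorial * pr n) ≤ _
  rw [mul_left_comm]
  refine mul_le_mul_of_nonneg_left ?_ hf
  linarith
end
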